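/- arXiv:1607.00232 — 2 statements merged into one kernel-verified Lean document; each statement's English description precedes it below -/
import Mathlib

section
/- Suppose the external field F₀ is constant (hence, since ∫_{[0,1]²} F₀ = 2πd, F₀ ≡ 2πd). Then λ₁ = 2π|d|. -/
open MeasureTheory Complex

noncomputable section

/-- Partial derivative in the first coordinate direction. -/
def pd1 {E : Type*} [NormedAddCommGroup E] [NormedSpace ℝ E]
    (f : ℝ × ℝ → E) (x : ℝ × ℝ) : E := fderiv ℝ f x (1, 0)

/-- Partial derivative in the second coordinate direction. -/
def pd2 {E : Type*} [NormedAddCommGroup E] [NormedSpace ℝ E]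
    (f : ℝ × ℝ → E) (x : ℝ × ℝ) : E := fderiv ℝ f x (0, 1)

/-- Covariant derivative `D₁φ = ∂₁φ + i a₁ φ`. -/
def D1 (a1 : ℝ × ℝ → ℝ) (φ : ℝ × ℝ → ℂ) : ℝ × ℝ → ℂ :=
  fun x => pd1 φ x + Complex.I * (a1 x : ℂ) * φ x

/-- Covariant derivative `D₂φ = ∂₂φ + i a₂ φ`. -/
def D2 (a2 : ℝ × ℝ → ℝ) (φ : ℝ × ℝ → ℂ) : ℝ × ℝ → ℂ :=
  fun x => pd2 φ x + Complex.I * (a2 x : ℂ) * φ x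

/-- Curvature `F(a) = ∂₁a₂ − ∂₂a₁`. -/
def curv (a1 a2 : ℝ × ℝ → ℝ) : ℝ × ℝ → ℝ :=
  fun x => pd1 a2 x - pd2 a1 x

/-- The fundamental domain `[0,1]²`. -/
def unitSquare : Set (ℝ × ℝ) := Set.Icc (0, 0) (1, 1)

/-- A degree-`d` field pair on the torus: smooth quasi-periodic `(a, φ)`. -/
structure FieldPair (d : ℤ) where
  a1 : ℝ × ℝ → ℝ
  a2 : ℝ × ℝ → ℝ
  φ : ℝ × ℝ → ℂ
  smooth_a1 : ContDiff ℝ (⊤ : ℕ∞) a1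
  smooth_a2 : ContDiff ℝ (⊤ : ℕ∞) a2
  smooth_φ : ContDiff ℝ (⊤ : ℕ∞) φ
  per1_a1 : ∀ x : ℝ × ℝ, a1 (x.1 + 1, x.2) = a1 x
  per1_a2 : ∀ x : ℝ × ℝ, a2 (x.1 + 1, x.2) = a2 x
  per1_φ : ∀ x : ℝ × ℝ, φ (x.1 + 1, x.2) = φ x
  per2_a2 : ∀ x : ℝ × ℝ, a2 (x.1, x.2 + 1) = a2 x
  per2_a1 : ∀ x : ℝ × ℝ, a1 (x.1, x.2 + 1) = a1 x - 2 * Real.pi * d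
  per2_φ : ∀ x : ℝ × ℝ, φ (x.1, x.2 + 1) =
      Complex.exp (2 * Real.pi * Complex.I * (d : ℂ) * (x.1 : ℂ)) * φ x

/-- The smooth ℤ²-periodic external field with `∫_{[0,1]²} F₀ = 2πd`. -/
def ExternalField (d : ℤ) (F₀ : ℝ × ℝ → ℝ) : Prop :=
  ContDiff ℝ (⊤ : ℕ∞) F₀ ∧ (∀ x : ℝ × ℝ, F₀ (x.1 + 1, x.2) = F₀ x) ∧
    (∀ x : ℝ × ℝ, F₀ (x.1, x.2 + 1) = F₀ x) ∧
    (∫ x in unitSquare, F₀ x) = 2 * Real.pi * d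

/-- The Ginzburg–Landau free energy. -/
def energy (α β : ℝ) (F₀ : ℝ × ℝ → ℝ) {d : ℤ} (P : FieldPair d) : ℝ :=
  (1 / 2) * ∫ x in unitSquare,
    ((curv P.a1 P.a2 x - F₀ x) ^ 2 + ‖D1 P.a1 P.φ x‖ ^ 2 + ‖D2 P.a2 P.φ x‖ ^ 2
      - α * ‖P.φ x‖ ^ 2 + (β / 2) * ‖P.φ x‖ ^ 4)

/-- The Ginzburg–Landau equations. -/
def IsGLSolution (α β : ℝ) (F₀ : ℝ × ℝ → ℝ) {d : ℤ} (P : FieldPair d) : Prop :=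
  (∀ x : ℝ × ℝ,
      pd2 (fun y => curv P.a1 P.a2 y - F₀ y) x
        + ((starRingEnd ℂ) (P.φ x) * D1 P.a1 P.φ x).im = 0) ∧
  (∀ x : ℝ × ℝ,
      -pd1 (fun y => curv P.a1 P.a2 y - F₀ y) x
        + ((starRingEnd ℂ) (P.φ x) * D2 P.a2 P.φ x).im = 0) ∧
  (∀ x : ℝ × ℝ,
      -(D1 P.a1 (D1 P.a1 P.φ) x + D2 P.a2 (D2 P.a2 P.φ) x)
        = (α : ℂ) * P.φ x - (β : ℂ) * (‖P.φ x‖ : ℂ) ^ 2 * P.φ x)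

/-- The set of energies of all degree-`d` field pairs. -/
def energySet (α β : ℝ) (F₀ : ℝ × ℝ → ℝ) (d : ℤ) : Set ℝ :=
  { t : ℝ | ∃ P : FieldPair d, t = energy α β F₀ P }

/-- `λ₁`, the lowest eigenvalue of the covariant Laplacian among connections
with curvature `F₀`. -/
def lambda1 (d : ℤ) (F₀ : ℝ × ℝ → ℝ) : ℝ :=
  sInf { t : ℝ | ∃ P : FieldPair d,
    (∀ x : ℝ × ℝ, curv P.a1 P.a2 x = F₀ x) ∧
    (∫ x in unitSquare, ‖P.φ x‖ ^ 2) = 1 ∧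
    t = ∫ x in unitSquare, (‖D1 P.a1 P.φ x‖ ^ 2 + ‖D2 P.a2 P.φ x‖ ^ 2) }

open scoped ComplexConjugate

section Calculus

variable {φ : ℝ × ℝ → ℂ} {a a1 a2 : ℝ × ℝ → ℝ}

lemma contDiff_fderiv_apply_const {E : Type*} [NormedAddCommGroup E] [NormedSpace ℝ E]
    {f : ℝ × ℝ → E} (hf : ContDiff ℝ (⊤ : ℕ∞) f) (v : ℝ × ℝ) :
    ContDiff ℝ (⊤ : ℕ∞) (fun x => fderiv ℝ f x v) :=
  (hf.fderiv_right (m := (⊤ : ℕ∞)) (by norm_cast)).clm_apply contDiff_const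

lemma contDiff_covariant_fderiv (hφ : ContDiff ℝ (⊤ : ℕ∞) φ) (ha : ContDiff ℝ (⊤ : ℕ∞) a)
    (w : ℝ × ℝ) :
    ContDiff ℝ (⊤ : ℕ∞) (fun x => fderiv ℝ φ x w + I * (a x : ℂ) * φ x) :=
  (contDiff_fderiv_apply_const hφ w).add
    ((contDiff_const.mul (ofRealCLM.contDiff.comp ha)).mul hφ)

lemma contDiff_current (hφ : ContDiff ℝ (⊤ : ℕ∞) φ) (ha : ContDiff ℝ (⊤ : ℕ∞) a)
    (w : ℝ × ℝ) :
    ContDiff ℝ (⊤ : ℕ∞)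
      (fun x => (conj (φ x) * (fderiv ℝ φ x w + I * (a x : ℂ) * φ x)).im) :=
  imCLM.contDiff.comp
    ((conjCLE.contDiff.comp hφ).mul (contDiff_covariant_fderiv hφ ha w))

lemma fderiv_current (hφ : ContDiff ℝ (⊤ : ℕ∞) φ) (ha : ContDiff ℝ (⊤ : ℕ∞) a)
    (v w x : ℝ × ℝ) :
    fderiv ℝ (fun y => (conj (φ y) * (fderiv ℝ φ y w + I * (a y : ℂ) * φ y)).im) x v =
      (conj (fderiv ℝ φ x v) * (fderiv ℝ φ x w + I * (a x : ℂ) * φ x) +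
        conj (φ x) * (fderiv ℝ (fderiv ℝ φ) x v w + I * (fderiv ℝ a x v : ℂ) * φ x +
          I * (a x : ℂ) * fderiv ℝ φ x v)).im := by
  have h0 : HasFDerivAt φ (fderiv ℝ φ x) x :=
    (hφ.differentiable (by simp) x).hasFDerivAt
  have h1 : HasFDerivAt a (fderiv ℝ a x) x :=
    (ha.differentiable (by simp) x).hasFDerivAt
  have h2 : HasFDerivAt (fderiv ℝ φ) (fderiv ℝ (fderiv ℝ φ) x) x :=
    ((hφ.fderiv_right (m := (⊤ : ℕ∞)) (by norm_cast)).differentiable (by simp) x).hasFDerivAt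
  have h3 := h2.clm_apply (hasFDerivAt_const w x)
  have h4 := (ofRealCLM.hasFDerivAt.comp x h1).const_mul I
  have h5 := (conjCLE.toContinuousLinearMap.hasFDerivAt.comp x h0).mul (h3.add (h4.mul h0))
  have h6 := imCLM.hasFDerivAt.comp x h5
  refine (congrArg (fun L => L v) h6.fderiv).trans ?_
  simp
  ring

/-- The curl of the current `Im(conj φ · Dφ)`. -/
lemma curl_current (hφ : ContDiff ℝ (⊤ : ℕ∞) φ) (ha1 : ContDiff ℝ (⊤ : ℕ∞) a1)
    (ha2 : ContDiff ℝ (⊤ : ℕ∞) a2) (x : ℝ × ℝ) :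
    pd1 (fun y => (conj (φ y) * D2 a2 φ y).im) x -
        pd2 (fun y => (conj (φ y) * D1 a1 φ y).im) x =
      2 * (conj (D1 a1 φ x) * D2 a2 φ x).im + curv a1 a2 x * ‖φ x‖ ^ 2 := by
  have hs : fderiv ℝ (fderiv ℝ φ) x (1, 0) (0, 1) = fderiv ℝ (fderiv ℝ φ) x (0, 1) (1, 0) :=
    (hφ.contDiffAt.isSymmSndFDerivAt (by simp; norm_cast)).eq _ _
  simp only [pd1, pd2, D1, D2, curv]
  rw [fderiv_current hφ ha2, fderiv_current hφ ha1, hs, ← normSq_eq_norm_sq, normSq_apply]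
  simp
  ring

end Calculus

lemma integrableOn_unitSquare {f : ℝ × ℝ → ℝ} (hf : Continuous f) :
    IntegrableOn f unitSquare :=
  hf.continuousOn.integrableOn_compact isCompact_Icc

lemma abs_two_mul_im_conj_mul_le (z w : ℂ) : |2 * (conj z * w).im| ≤ ‖z‖ ^ 2 + ‖w‖ ^ 2 := by
  have h : |(conj z * w).im| ≤ ‖z‖ * ‖w‖ := by
    simpa using abs_im_le_norm (conj z * w)
  rw [abs_mul, abs_two]
  nlinarith [sq_nonneg (‖z‖ - ‖w‖)]

namespace FieldPair

variable {d : ℤ} (P : FieldPair d)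

lemma contDiff_D1 : ContDiff ℝ (⊤ : ℕ∞) (D1 P.a1 P.φ) :=
  contDiff_covariant_fderiv P.smooth_φ P.smooth_a1 _

lemma contDiff_D2 : ContDiff ℝ (⊤ : ℕ∞) (D2 P.a2 P.φ) :=
  contDiff_covariant_fderiv P.smooth_φ P.smooth_a2 _

lemma D2_add_fst (x : ℝ × ℝ) : D2 P.a2 P.φ (x.1 + 1, x.2) = D2 P.a2 P.φ x := by
  have h : (fun y : ℝ × ℝ => P.φ (y + (1, 0))) = P.φ := by
    funext y
    simpa [Prod.add_def] using P.per1_φ y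
  have h' : fderiv ℝ P.φ (x + (1, 0)) = fderiv ℝ P.φ x := by
    rw [← fderiv_comp_add_right, h]
  have hx : x + (1, 0) = (x.1 + 1, x.2) := by simp [Prod.add_def]
  rw [hx] at h'
  simp only [D2, pd2, h', P.per1_a2, P.per1_φ]

lemma D1_add_snd (x : ℝ × ℝ) :
    D1 P.a1 P.φ (x.1, x.2 + 1) =
      cexp (2 * Real.pi * I * (d : ℂ) * (x.1 : ℂ)) * D1 P.a1 P.φ x := by
  have h : (fun y : ℝ × ℝ => P.φ (y + (0, 1))) =
      fun y => cexp (2 * Real.pi * I * (d : ℂ) * (y.1 : ℂ)) * P.φ y := by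
    funext y
    simpa [Prod.add_def] using P.per2_φ y
  have hlin : HasFDerivAt (fun y : ℝ × ℝ => 2 * Real.pi * I * (d : ℂ) * (y.1 : ℂ))
      ((2 * Real.pi * I * (d : ℂ)) • ofRealCLM.comp (ContinuousLinearMap.fst ℝ ℝ ℝ)) x :=
    (ofRealCLM.comp (ContinuousLinearMap.fst ℝ ℝ ℝ)).hasFDerivAt.const_mul _
  have hφ : HasFDerivAt P.φ (fderiv ℝ P.φ x) x :=
    (P.smooth_φ.differentiable (by simp) x).hasFDerivAt
  have h' := (hlin.cexp.mul hφ).fderiv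
  have h'' := (fderiv_comp_add_right (𝕜 := ℝ) (f := P.φ) (x := x) (0, 1)).symm.trans
    ((congrArg (fun f => fderiv ℝ f x) h).trans h')
  have hx : x + (0, 1) = (x.1, x.2 + 1) := by simp [Prod.add_def]
  rw [hx] at h''
  simp only [D1, pd1, h'', P.per2_a1, P.per2_φ]
  simp
  ring

lemma current_fst_add_snd (x : ℝ × ℝ) :
    conj (P.φ (x.1, x.2 + 1)) * D1 P.a1 P.φ (x.1, x.2 + 1) =
      conj (P.φ x) * D1 P.a1 P.φ x := by
  have hn : conj (cexp (2 * Real.pi * I * (d : ℂ) * (x.1 : ℂ))) *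
      cexp (2 * Real.pi * I * (d : ℂ) * (x.1 : ℂ)) = 1 := by
    rw [← exp_conj, ← Complex.exp_add]
    simp [conj_ofNat]
  rw [D1_add_snd, P.per2_φ, map_mul]
  linear_combination (conj (P.φ x) * D1 P.a1 P.φ x) * hn

/-- Weitzenböck-type identity: the integrated curl of the current vanishes. -/
lemma integral_im_conj_D1_mul_D2 {c : ℝ} (hc : ∀ x, curv P.a1 P.a2 x = c) :
    ∫ x in unitSquare, 2 * (conj (D1 P.a1 P.φ x) * D2 P.a2 P.φ x).im =
      -c * ∫ x in unitSquare, ‖P.φ x‖ ^ 2 := by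
  set J1 : ℝ × ℝ → ℝ := fun y => (conj (P.φ y) * D1 P.a1 P.φ y).im
  set J2 : ℝ × ℝ → ℝ := fun y => (conj (P.φ y) * D2 P.a2 P.φ y).im
  have h1 : ContDiff ℝ (⊤ : ℕ∞) J1 := contDiff_current P.smooth_φ P.smooth_a1 _
  have h2 : ContDiff ℝ (⊤ : ℕ∞) J2 := contDiff_current P.smooth_φ P.smooth_a2 _
  have hcurl : ∀ x, fderiv ℝ J2 x (1, 0) + (-fderiv ℝ J1 x) (0, 1) =
      2 * (conj (D1 P.a1 P.φ x) * D2 P.a2 P.φ x).im + c * ‖P.φ x‖ ^ 2 := fun x => by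
    rw [← hc x, ← curl_current P.smooth_φ P.smooth_a1 P.smooth_a2 x, sub_eq_add_neg]
    rfl
  have hcont : Continuous fun x => 2 * (conj (D1 P.a1 P.φ x) * D2 P.a2 P.φ x).im :=
    continuous_const.mul (continuous_im.comp
      ((continuous_conj.comp P.contDiff_D1.continuous).mul P.contDiff_D2.continuous))
  have hcont' : Continuous fun x => c * ‖P.φ x‖ ^ 2 := by
    have := P.smooth_φ.continuous
    fun_prop
  have hdiv := integral_divergence_prod_Icc_of_hasFDerivAt_of_le J2 (fun x => -J1 x)
    (fun x => fderiv ℝ J2 x) (fun x => -fderiv ℝ J1 x) (0, 0) (1, 1) (by simp)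
    h2.continuous.continuousOn h1.continuous.neg.continuousOn
    (fun x _ => (h2.differentiable (by simp) x).hasFDerivAt)
    (fun x _ => (h1.differentiable (by simp) x).hasFDerivAt.neg)
    (by
      simp only [hcurl]
      exact integrableOn_unitSquare (hcont.add hcont'))
  have hJ1 : ∀ s : ℝ, J1 (s, 1) = J1 (s, 0) := fun s => by
    simpa [J1] using congrArg im (P.current_fst_add_snd (s, 0))
  have hJ2 : ∀ s : ℝ, J2 (1, s) = J2 (0, s) := fun s => by
    have e1 := P.D2_add_fst (0, s)
    have e2 := P.per1_φ (0, s)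
    simp only [zero_add] at e1 e2
    simp only [J2, e1, e2]
  simp only [hcurl, hJ1, hJ2] at hdiv
  have hadd := integral_add (integrableOn_unitSquare hcont) (integrableOn_unitSquare hcont')
  rw [integral_const_mul c] at hadd
  have : ∫ x in unitSquare, (2 * (conj (D1 P.a1 P.φ x) * D2 P.a2 P.φ x).im + c * ‖P.φ x‖ ^ 2)
      = 0 := hdiv.trans (by ring)
  linarith

lemma abs_curv_mul_le {c : ℝ} (hc : ∀ x, curv P.a1 P.a2 x = c) :
    |c| * ∫ x in unitSquare, ‖P.φ x‖ ^ 2 ≤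
      ∫ x in unitSquare, (‖D1 P.a1 P.φ x‖ ^ 2 + ‖D2 P.a2 P.φ x‖ ^ 2) := by
  have hN : 0 ≤ ∫ x in unitSquare, ‖P.φ x‖ ^ 2 := integral_nonneg fun x => by positivity
  rw [← abs_neg, ← abs_of_nonneg hN, ← abs_mul, ← P.integral_im_conj_D1_mul_D2 hc,
    ← Real.norm_eq_abs]
  have hcont : Continuous fun x => ‖D1 P.a1 P.φ x‖ ^ 2 + ‖D2 P.a2 P.φ x‖ ^ 2 :=
    (P.contDiff_D1.continuous.norm.pow 2).add (P.contDiff_D2.continuous.norm.pow 2)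
  exact norm_integral_le_of_norm_le (integrableOn_unitSquare hcont)
    (Filter.Eventually.of_forall fun x => abs_two_mul_im_conj_mul_le _ _)

/-- The lower bound is attained by (anti)holomorphic sections. -/
lemma integral_eq_of_holomorphic (hd : d ≠ 0)
    (hc : ∀ x, curv P.a1 P.a2 x = 2 * Real.pi * d)
    (hol : ∀ x, (d : ℂ) * D2 P.a2 P.φ x = -(I * |(d : ℝ)|) * D1 P.a1 P.φ x) :
    ∫ x in unitSquare, (‖D1 P.a1 P.φ x‖ ^ 2 + ‖D2 P.a2 P.φ x‖ ^ 2) =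
      2 * Real.pi * |(d : ℝ)| * ∫ x in unitSquare, ‖P.φ x‖ ^ 2 := by
  have hd' : (d : ℝ) ≠ 0 := by exact_mod_cast hd
  have hd0 : 0 < |(d : ℝ)| := abs_pos.mpr hd'
  have hpt : ∀ x, ‖D1 P.a1 P.φ x‖ ^ 2 + ‖D2 P.a2 P.φ x‖ ^ 2 =
      -(d / |(d : ℝ)|) * (2 * (conj (D1 P.a1 P.φ x) * D2 P.a2 P.φ x).im) := fun x => by
    have hn : ‖D2 P.a2 P.φ x‖ = ‖D1 P.a1 P.φ x‖ := by
      have := congrArg norm (hol x)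
      simp only [norm_mul, norm_neg, norm_I, norm_real, norm_intCast, Real.norm_eq_abs, abs_abs,
        one_mul] at this
      exact mul_left_cancel₀ hd0.ne' this
    have him : d * (conj (D1 P.a1 P.φ x) * D2 P.a2 P.φ x).im =
        -|(d : ℝ)| * ‖D1 P.a1 P.φ x‖ ^ 2 := by
      have h : ((d : ℝ) : ℂ) * (conj (D1 P.a1 P.φ x) * D2 P.a2 P.φ x) =
          ((-|(d : ℝ)| * ‖D1 P.a1 P.φ x‖ ^ 2 : ℝ) : ℂ) * I := by
        have := conj_mul' (D1 P.a1 P.φ x)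
        push_cast
        linear_combination conj (D1 P.a1 P.φ x) * hol x - I * ((|(d : ℝ)| : ℝ) : ℂ) * this
      have := congrArg im h
      rwa [im_ofReal_mul, im_ofReal_mul, I_im, mul_one] at this
    rw [hn]
    field_simp
    linarith
  simp only [hpt]
  rw [integral_const_mul, P.integral_im_conj_D1_mul_D2 hc]
  have := sq_abs (d : ℝ)
  field_simp
  rw [this]

end FieldPair

section Theta

/-- The theta-function section of the degree-`d` bundle, with `τ = i|d|`. -/
def thetaSection (d : ℤ) (x : ℝ × ℝ) : ℂ :=
  cexp (Real.pi * I * (I * |(d : ℝ)|) * x.2 ^ 2) *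
    jacobiTheta₂ ((I * |(d : ℝ)|) * x.2 - d * x.1) (I * |(d : ℝ)|)

variable {d : ℤ}

lemma im_I_mul_abs_pos (hd : d ≠ 0) : 0 < (I * ((|(d : ℝ)| : ℝ) : ℂ)).im := by
  simpa using hd

lemma thetaSection_add_fst (d : ℤ) (x : ℝ × ℝ) :
    thetaSection d (x.1 + 1, x.2) = thetaSection d x := by
  have hper : Function.Periodic (fun z => jacobiTheta₂ z (I * |(d : ℝ)|)) 1 :=
    fun z => jacobiTheta₂_add_left z _
  have h := (hper.int_mul d).sub_eq ((I * |(d : ℝ)|) * x.2 - d * x.1)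
  simp only [mul_one] at h
  simp only [thetaSection, ← h]
  push_cast
  ring_nf

lemma thetaSection_add_snd (d : ℤ) (x : ℝ × ℝ) :
    thetaSection d (x.1, x.2 + 1) =
      cexp (2 * Real.pi * I * (d : ℂ) * (x.1 : ℂ)) * thetaSection d x := by
  simp only [thetaSection]
  generalize (I * ((|(d : ℝ)| : ℝ) : ℂ)) = τ
  have hz : τ * ((x.2 + 1 : ℝ) : ℂ) - d * x.1 = (τ * x.2 - d * x.1) + τ := by
    push_cast
    ring
  rw [hz, jacobiTheta₂_add_left', ← mul_assoc, ← mul_assoc, ← Complex.exp_add, ← Complex.exp_add]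
  congr 2
  push_cast
  ring

lemma contDiff_thetaSection (hd : d ≠ 0) : ContDiff ℝ (⊤ : ℕ∞) (thetaSection d) := by
  have hθ : ContDiff ℂ (⊤ : ℕ∞) (fun z => jacobiTheta₂ z (I * |(d : ℝ)|)) :=
    Differentiable.contDiff
      (fun z => differentiableAt_jacobiTheta₂_fst z (im_I_mul_abs_pos hd))
  have h1 : ContDiff ℝ (⊤ : ℕ∞) (fun x : ℝ × ℝ => (x.1 : ℂ)) :=
    ofRealCLM.contDiff.comp contDiff_fst
  have h2 : ContDiff ℝ (⊤ : ℕ∞) (fun x : ℝ × ℝ => (x.2 : ℂ)) :=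
    ofRealCLM.contDiff.comp contDiff_snd
  exact (contDiff_const.mul (h2.pow 2)).cexp.mul ((hθ.restrict_scalars ℝ).comp
    ((contDiff_const.mul h2).sub (contDiff_const.mul h1)))

lemma fderiv_thetaSection (hd : d ≠ 0) (x v : ℝ × ℝ) :
    fderiv ℝ (thetaSection d) x v =
      cexp (Real.pi * I * (I * |(d : ℝ)|) * x.2 ^ 2) *
        (((I * |(d : ℝ)|) * v.2 - d * v.1) *
            jacobiTheta₂' ((I * |(d : ℝ)|) * x.2 - d * x.1) (I * |(d : ℝ)|) +
          2 * Real.pi * I * (I * |(d : ℝ)|) * x.2 * v.2 *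
            jacobiTheta₂ ((I * |(d : ℝ)|) * x.2 - d * x.1) (I * |(d : ℝ)|)) := by
  have h1 : HasFDerivAt (fun x : ℝ × ℝ => (x.1 : ℂ))
      (ofRealCLM.comp (ContinuousLinearMap.fst ℝ ℝ ℝ)) x :=
    (ofRealCLM.comp (ContinuousLinearMap.fst ℝ ℝ ℝ)).hasFDerivAt
  have h2 : HasFDerivAt (fun x : ℝ × ℝ => (x.2 : ℂ))
      (ofRealCLM.comp (ContinuousLinearMap.snd ℝ ℝ ℝ)) x :=
    (ofRealCLM.comp (ContinuousLinearMap.snd ℝ ℝ ℝ)).hasFDerivAt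
  have hθ := (hasDerivAt_jacobiTheta₂_fst ((I * |(d : ℝ)|) * x.2 - d * x.1)
    (im_I_mul_abs_pos hd)).comp_hasFDerivAt x
      ((h2.const_mul (I * ((|(d : ℝ)| : ℝ) : ℂ))).sub (h1.const_mul (d : ℂ)))
  have h := ((h2.pow 2).const_mul (Real.pi * I * (I * ((|(d : ℝ)| : ℝ) : ℂ)))).cexp.mul hθ
  refine (congrArg (fun L => L v) h.fderiv).trans ?_
  simp
  ring

lemma thetaSection_zero_ne_zero (hd : d ≠ 0) : thetaSection d (0, 0) ≠ 0 := by
  have hs := hasSum_jacobiTheta₂_term 0 (im_I_mul_abs_pos hd)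
  have hterm : ∀ n : ℤ, jacobiTheta₂_term n 0 (I * |(d : ℝ)|) =
      (Real.exp (-(Real.pi * n ^ 2 * |(d : ℝ)|)) : ℂ) := fun n => by
    rw [jacobiTheta₂_term]
    push_cast
    congr 1
    linear_combination Real.pi * n ^ 2 * ((|(d : ℝ)| : ℝ) : ℂ) * I_mul_I
  simp only [hterm] at hs
  have hre := hasSum_re hs
  simp only [ofReal_re] at hre
  have hpos : 0 < (jacobiTheta₂ 0 (I * |(d : ℝ)|)).re := by
    rw [← hre.tsum_eq]
    exact hre.summable.tsum_pos (fun n => (Real.exp_pos _).le) 0 (Real.exp_pos _)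
  have : thetaSection d (0, 0) = jacobiTheta₂ 0 (I * |(d : ℝ)|) := by
    simp [thetaSection]
  rw [this]
  intro h0
  simp [h0] at hpos

lemma integral_norm_sq_pos {f : ℝ × ℝ → ℂ} (hf : Continuous f) (h0 : f (0, 0) ≠ 0) :
    0 < ∫ x in unitSquare, ‖f x‖ ^ 2 := by
  have hcont : Continuous fun x => ‖f x‖ ^ 2 := hf.norm.pow 2
  rw [setIntegral_pos_iff_support_of_nonneg_ae
    (Filter.Eventually.of_forall fun x => by positivity)
    (integrableOn_unitSquare hcont)]
  have hopen : IsOpen (Function.support fun x => ‖f x‖ ^ 2) := hcont.isOpen_support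
  have hmem : ((0 : ℝ), (0 : ℝ)) ∈ closure (Set.Ioo (0 : ℝ) 1 ×ˢ Set.Ioo (0 : ℝ) 1) := by
    rw [closure_prod_eq, closure_Ioo (by norm_num)]
    simp
  have hne := mem_closure_iff.mp hmem _ hopen (by simpa using h0)
  refine ((hopen.inter (isOpen_Ioo.prod isOpen_Ioo)).measure_pos volume hne).trans_le
    (measure_mono (Set.inter_subset_inter_right _ ?_))
  rintro ⟨x, y⟩ ⟨hx, hy⟩
  exact ⟨⟨hx.1.le, hy.1.le⟩, ⟨hx.2.le, hy.2.le⟩⟩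

lemma fderiv_landau_potential (x : ℝ × ℝ) :
    fderiv ℝ (fun x : ℝ × ℝ => -(2 * Real.pi * d) * x.2) x =
      -(2 * Real.pi * d) • ContinuousLinearMap.snd ℝ ℝ ℝ :=
  ((ContinuousLinearMap.snd ℝ ℝ ℝ).hasFDerivAt.const_mul (-(2 * Real.pi * (d : ℝ)))).fderiv

/-- A multiple of the theta section, in the Landau gauge. -/
def thetaPair (hd : d ≠ 0) (k : ℂ) : FieldPair d where
  a1 x := -(2 * Real.pi * d) * x.2
  a2 _ := 0
  φ x := k * thetaSection d x
  smooth_a1 := contDiff_const.mul contDiff_snd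
  smooth_a2 := contDiff_const
  smooth_φ := contDiff_const.mul (contDiff_thetaSection hd)
  per1_a1 _ := rfl
  per1_a2 _ := rfl
  per1_φ x := by rw [thetaSection_add_fst]
  per2_a2 _ := rfl
  per2_a1 x := by ring
  per2_φ x := by
    rw [thetaSection_add_snd]
    ring

lemma curv_thetaPair (hd : d ≠ 0) (k : ℂ) (x : ℝ × ℝ) :
    curv (thetaPair hd k).a1 (thetaPair hd k).a2 x = 2 * Real.pi * d := by
  simp only [curv, pd1, pd2, thetaPair, fderiv_landau_potential]
  simp

lemma thetaPair_holomorphic (hd : d ≠ 0) (k : ℂ) (x : ℝ × ℝ) :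
    (d : ℂ) * D2 (thetaPair hd k).a2 (thetaPair hd k).φ x =
      -(I * |(d : ℝ)|) * D1 (thetaPair hd k).a1 (thetaPair hd k).φ x := by
  have hk : fderiv ℝ (fun x => k * thetaSection d x) x = k • fderiv ℝ (thetaSection d) x :=
    fderiv_const_mul ((contDiff_thetaSection hd).differentiable (by simp) x) k
  simp only [D1, D2, pd1, pd2, thetaPair, hk, smul_apply, smul_eq_mul, fderiv_thetaSection hd]
  simp only [thetaSection]
  push_cast
  ring

end Theta

/-- The flat pair with a constant section. -/
def trivialPair : FieldPair 0 where
  a1 _ := 0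
  a2 _ := 0
  φ _ := 1
  smooth_a1 := contDiff_const
  smooth_a2 := contDiff_const
  smooth_φ := contDiff_const
  per1_a1 _ := rfl
  per1_a2 _ := rfl
  per1_φ _ := rfl
  per2_a2 _ := rfl
  per2_a1 _ := by simp
  per2_φ _ := by simp

lemma volume_real_unitSquare : volume.real unitSquare = 1 := by
  rw [unitSquare, measureReal_def, ← Set.Icc_prod_Icc, Measure.volume_eq_prod, Measure.prod_prod]
  simp

lemma exists_minimizer (d : ℤ) : ∃ P : FieldPair d,
    (∀ x, curv P.a1 P.a2 x = 2 * Real.pi * d) ∧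
    (∫ x in unitSquare, ‖P.φ x‖ ^ 2) = 1 ∧
    ∫ x in unitSquare, (‖D1 P.a1 P.φ x‖ ^ 2 + ‖D2 P.a2 P.φ x‖ ^ 2) =
      2 * Real.pi * |(d : ℝ)| := by
  rcases eq_or_ne d 0 with rfl | hd
  · refine ⟨trivialPair, fun x => ?_, ?_, ?_⟩
    · simp [curv, pd1, pd2, trivialPair]
    · simp [trivialPair, volume_real_unitSquare]
    · simp [D1, D2, pd1, pd2, trivialPair]
  · have hN := integral_norm_sq_pos (contDiff_thetaSection hd).continuous
      (thetaSection_zero_ne_zero hd)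
    set N := ∫ x in unitSquare, ‖thetaSection d x‖ ^ 2
    set P := thetaPair hd (((√N)⁻¹ : ℝ) : ℂ)
    have hone : ∫ x in unitSquare, ‖P.φ x‖ ^ 2 = 1 := by
      have : ∀ x, ‖P.φ x‖ ^ 2 = N⁻¹ * ‖thetaSection d x‖ ^ 2 := fun x => by
        simp only [P, thetaPair, norm_mul, norm_real, mul_pow, Real.norm_eq_abs, sq_abs, inv_pow,
          Real.sq_sqrt hN.le]
      simp only [this]
      rw [integral_const_mul]
      exact inv_mul_cancel₀ hN.ne'
    refine ⟨P, curv_thetaPair hd _, hone, ?_⟩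
    rw [P.integral_eq_of_holomorphic hd (curv_thetaPair hd _) (thetaPair_holomorphic hd _), hone,
      mul_one]

/-- if the external field `F₀` is constant then `λ₁ = 2π|d|`. -/
theorem statement3 (α β : ℝ) (hα : 0 < α) (hβ : 0 < β) (d : ℤ) (F₀ : ℝ × ℝ → ℝ)
    (hF₀ : ExternalField d F₀) (hconst : ∃ c : ℝ, ∀ x : ℝ × ℝ, F₀ x = c) :
    lambda1 d F₀ = 2 * Real.pi * |(d : ℝ)| := by
  obtain ⟨c, hc⟩ := hconst
  have hcd : c = 2 * Real.pi * d := by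
    have h := hF₀.2.2.2
    simpa [hc, volume_real_unitSquare] using h
  have habs : |c| = 2 * Real.pi * |(d : ℝ)| := by
    rw [hcd, abs_mul, abs_of_pos Real.two_pi_pos]
  refine IsLeast.csInf_eq ⟨?_, ?_⟩
  · obtain ⟨P, hP, hN, hE⟩ := exists_minimizer d
    exact ⟨P, fun x => by rw [hP, hc, hcd], hN, hE.symm⟩
  · rintro t ⟨P, hP, hN, rfl⟩
    have h := P.abs_curv_mul_le fun x => (hP x).trans (hc x)
    rwa [hN, mul_one, habs] at h
end
end

section
/- If a degree-d GL solution (a,φ) satisfies |φ(x₀)| = √(α/β) at some point x₀ ∈ ℝ², then |φ(x)| = √(α/β) for every x ∈ ℝ², and d = 0 (the underlying line bundle is trivial). -/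
open MeasureTheory Complex

noncomputable section

theorem fderiv_fderiv_nonneg_of_isLocalMin {E : Type*} [NormedAddCommGroup E] [NormedSpace ℝ E]
    {f : E → ℝ} (hf : ContDiff ℝ 2 f) {z : E} (hz : IsLocalMin f z) (v : E) :
    0 ≤ fderiv ℝ (fun y => fderiv ℝ f y v) z v := by
  have hline : ∀ t : ℝ, HasDerivAt (fun s : ℝ => z + s • v) v t := fun t => by
    simpa using ((hasDerivAt_id t).smul_const v).const_add z
  have hslice : ∀ {g : E → ℝ}, Differentiable ℝ g →
      deriv (fun t : ℝ => g (z + t • v)) = fun t => fderiv ℝ g (z + t • v) v := fun hg =>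
    funext fun t => ((hg _).hasFDerivAt.comp_hasDerivAt t (hline t)).deriv
  have hf1 : Differentiable ℝ (fun y => fderiv ℝ f y v) :=
    ((hf.fderiv_right (m := 1) (by norm_num)).clm_apply contDiff_const).differentiable (by norm_num)
  have h1 := hslice (hf.differentiable (by norm_num))
  have h2 : deriv (deriv fun t : ℝ => f (z + t • v)) 0
      = fderiv ℝ (fun y => fderiv ℝ f y v) z v := by
    rw [h1, hslice hf1]; simp
  have hcont : ContinuousAt (fun t : ℝ => z + t • v) 0 := (hline 0).continuousAt
  have hmin : IsLocalMin (fun t : ℝ => f (z + t • v)) 0 := by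
    have : Filter.Tendsto (fun t : ℝ => z + t • v) (nhds 0) (nhds z) := by
      simpa [ContinuousAt] using hcont
    simpa [IsLocalMin, IsMinFilter] using this.eventually hz
  by_contra! hneg
  have hmax : IsLocalMax (fun t : ℝ => f (z + t • v)) 0 :=
    isLocalMax_of_deriv_deriv_neg (by rwa [h2]) hmin.deriv_eq_zero
      (hf.continuous.continuousAt.comp hcont)
  have hconst : (fun t : ℝ => f (z + t • v)) =ᶠ[nhds 0] fun _ => f (z + (0 : ℝ) • v) := by
    filter_upwards [hmin, hmax] with t ht ht' using le_antisymm ht' ht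
  have h3 := hconst.deriv.deriv_eq
  rw [h2] at h3
  simp at h3
  linarith

theorem contDiff_pd1 {E : Type*} [NormedAddCommGroup E] [NormedSpace ℝ E] {f : ℝ × ℝ → E}
    {m n : WithTop ℕ∞} (hf : ContDiff ℝ n f) (h : m + 1 ≤ n) : ContDiff ℝ m (pd1 f) :=
  (hf.fderiv_right h).clm_apply contDiff_const

theorem contDiff_pd2 {E : Type*} [NormedAddCommGroup E] [NormedSpace ℝ E] {f : ℝ × ℝ → E}
    {m n : WithTop ℕ∞} (hf : ContDiff ℝ n f) (h : m + 1 ≤ n) : ContDiff ℝ m (pd2 f) :=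
  (hf.fderiv_right h).clm_apply contDiff_const

/-- The squared Euclidean distance to `p`. -/
def sqDist (p x : ℝ × ℝ) : ℝ := (x.1 - p.1) ^ 2 + (x.2 - p.2) ^ 2

theorem contDiff_sqDist (p : ℝ × ℝ) {n : WithTop ℕ∞} : ContDiff ℝ n (sqDist p) := by
  unfold sqDist; fun_prop

theorem hasFDerivAt_exp_sqDist (k : ℝ) (p x : ℝ × ℝ) :
    HasFDerivAt (fun y => Real.exp (-k * sqDist p y))
      (Real.exp (-k * sqDist p x) • (-k • ((2 * (x.1 - p.1)) • ContinuousLinearMap.fst ℝ ℝ ℝ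
        + (2 * (x.2 - p.2)) • ContinuousLinearMap.snd ℝ ℝ ℝ))) x := by
  have h1 : HasFDerivAt (fun y : ℝ × ℝ => y.1 - p.1) (ContinuousLinearMap.fst ℝ ℝ ℝ) x :=
    hasFDerivAt_fst.sub_const _
  have h2 : HasFDerivAt (fun y : ℝ × ℝ => y.2 - p.2) (ContinuousLinearMap.snd ℝ ℝ ℝ) x :=
    hasFDerivAt_snd.sub_const _
  have := (((h1.pow 2).add (h2.pow 2)).const_mul (-k)).exp
  simpa [sqDist] using this

theorem pd1_exp_sqDist (k : ℝ) (p : ℝ × ℝ) :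
    pd1 (fun y => Real.exp (-k * sqDist p y))
      = fun x => -(2 * k) * (x.1 - p.1) * Real.exp (-k * sqDist p x) := by
  funext x
  rw [pd1, (hasFDerivAt_exp_sqDist k p x).fderiv]
  simp; ring

theorem pd2_exp_sqDist (k : ℝ) (p : ℝ × ℝ) :
    pd2 (fun y => Real.exp (-k * sqDist p y))
      = fun x => -(2 * k) * (x.2 - p.2) * Real.exp (-k * sqDist p x) := by
  funext x
  rw [pd2, (hasFDerivAt_exp_sqDist k p x).fderiv]
  simp; ring

theorem laplacian_exp_sqDist (k : ℝ) (p x : ℝ × ℝ) :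
    pd1 (pd1 fun y => Real.exp (-k * sqDist p y)) x
      + pd2 (pd2 fun y => Real.exp (-k * sqDist p y)) x
      = (4 * k ^ 2 * sqDist p x - 4 * k) * Real.exp (-k * sqDist p x) := by
  have h1 : HasFDerivAt (fun y : ℝ × ℝ => -(2 * k) * (y.1 - p.1))
      (-(2 * k) • ContinuousLinearMap.fst ℝ ℝ ℝ) x := (hasFDerivAt_fst.sub_const _).const_mul _
  have h2 : HasFDerivAt (fun y : ℝ × ℝ => -(2 * k) * (y.2 - p.2))
      (-(2 * k) • ContinuousLinearMap.snd ℝ ℝ ℝ) x := (hasFDerivAt_snd.sub_const _).const_mul _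
  rw [pd1_exp_sqDist, pd2_exp_sqDist, pd1, pd2,
    (h1.fun_mul (hasFDerivAt_exp_sqDist k p x)).fderiv,
    (h2.fun_mul (hasFDerivAt_exp_sqDist k p x)).fderiv]
  simp [sqDist]; ring

theorem isCompact_sqDist_le (p : ℝ × ℝ) (R : ℝ) : IsCompact {x | sqDist p x ≤ R} := by
  refine (isCompact_closedBall p (R + 1)).of_isClosed_subset
    (isClosed_le (contDiff_sqDist p (n := 0)).continuous continuous_const) fun x hx => ?_
  simp only [Set.mem_ofPred_eq, sqDist] at hx
  rw [Metric.mem_closedBall, Prod.dist_eq, max_le_iff, Real.dist_eq, Real.dist_eq]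
  constructor <;> apply abs_le_of_sq_le_sq <;>
    nlinarith [sq_nonneg (x.1 - p.1), sq_nonneg (x.2 - p.2)]

/-- Strong minimum principle for nonnegative functions with `Δw ≤ M w`. -/
theorem eq_zero_of_laplacian_le {w : ℝ × ℝ → ℝ} (hw : ContDiff ℝ 2 w) (hnn : ∀ x, 0 ≤ w x)
    {M : ℝ} (hM : 0 < M) (hlap : ∀ x, pd1 (pd1 w) x + pd2 (pd2 w) x ≤ M * w x)
    {x₀ : ℝ × ℝ} (hx₀ : w x₀ = 0) (p : ℝ × ℝ) : w p = 0 := by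
  by_contra hp
  have hp : 0 < w p := lt_of_le_of_ne (hnn p) (Ne.symm hp)
  obtain ⟨ε, hε, r, hr, hball⟩ : ∃ ε > 0, ∃ r > 0, ∀ x, sqDist p x ≤ r → ε ≤ w x := by
    obtain ⟨δ, hδ, h⟩ := Metric.eventually_nhds_iff.1
      (hw.continuous.continuousAt.eventually (lt_mem_nhds (half_lt_self hp)))
    refine ⟨w p / 2, by positivity, (δ / 2) ^ 2, by positivity, fun x hx => (h ?_).le⟩
    rw [Prod.dist_eq, max_lt_iff, Real.dist_eq, Real.dist_eq]
    unfold sqDist at hx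
    constructor <;> apply abs_lt_of_sq_lt_sq <;>
      nlinarith [sq_nonneg (x.1 - p.1), sq_nonneg (x.2 - p.2)]
  obtain ⟨k, hk, hkr⟩ : ∃ k > 0, ∀ s, r < s → M ≤ 4 * k ^ 2 * s - 4 * k := by
    refine ⟨1 + (1 + M) / r, by positivity, fun s hs => ?_⟩
    set k := 1 + (1 + M) / r with hkdef
    have hk1 : 1 ≤ k := le_add_of_nonneg_right (by positivity)
    have : k * r = r + (1 + M) := by rw [hkdef]; field_simp
    have h2 : 1 + M ≤ k * s := by nlinarith
    nlinarith [mul_le_mul_of_nonneg_left h2 (by linarith : (0:ℝ) ≤ k)]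
  set R := sqDist p x₀ + 1 with hR
  set h : ℝ × ℝ → ℝ := fun y => Real.exp (-k * sqDist p y) with hh
  set c := Real.exp (-k * R) with hc
  have hhC : ContDiff ℝ 2 h := Real.contDiff_exp.comp (contDiff_const.mul (contDiff_sqDist p))
  set v : ℝ × ℝ → ℝ := fun y => w y - ε * (h y - c) with hv
  have hvC : ContDiff ℝ 2 v := hw.sub (contDiff_const.mul (hhC.sub contDiff_const))
  have hx₀K : x₀ ∈ {x | sqDist p x ≤ R} := by simp [hR]
  obtain ⟨z, hzK, hz⟩ :=
    (isCompact_sqDist_le p R).exists_isMinOn ⟨x₀, hx₀K⟩ hvC.continuous.continuousOn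
  have hcpos : 0 < c := Real.exp_pos _
  have hvx₀ : v x₀ < 0 := by
    have : c < h x₀ := Real.exp_lt_exp.2 (by rw [hR]; linarith)
    simp only [hv, hx₀]; nlinarith
  have hvz : v z < 0 := (hz hx₀K).trans_lt hvx₀
  have hzR : sqDist p z < R := by
    refine lt_of_le_of_ne hzK fun he => ?_
    have : h z = c := by simp only [hh, hc, he]
    simp only [hv, this] at hvz
    linarith [hnn z]
  have hhz : 0 < h z := Real.exp_pos _
  have hzr : r < sqDist p z := by
    by_contra! hle
    have h1 := hball z hle
    have h0 : 0 ≤ sqDist p z := by unfold sqDist; positivity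
    have h2 : h z ≤ 1 := Real.exp_le_one_iff.2 (by nlinarith)
    simp only [hv] at hvz
    nlinarith
  have hloc : IsLocalMin v z := by
    filter_upwards [(contDiff_sqDist p (n := 0)).continuous.continuousAt.eventually
      (gt_mem_nhds hzR)] with y hy using hz (le_of_lt hy)
  have e1 : pd1 v = fun y => pd1 w y - ε * pd1 h y := by
    funext y
    have := ((hw.differentiable (by norm_num) y).hasFDerivAt.sub
      (((hhC.differentiable (by norm_num) y).hasFDerivAt.sub_const c).const_mul ε)).fderiv
    exact DFunLike.congr_fun this (1, 0)
  have e2 : pd2 v = fun y => pd2 w y - ε * pd2 h y := by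
    funext y
    have := ((hw.differentiable (by norm_num) y).hasFDerivAt.sub
      (((hhC.differentiable (by norm_num) y).hasFDerivAt.sub_const c).const_mul ε)).fderiv
    exact DFunLike.congr_fun this (0, 1)
  have f1 : pd1 (pd1 v) z = pd1 (pd1 w) z - ε * pd1 (pd1 h) z := by
    rw [e1]
    have := (((contDiff_pd1 (m := 1) hw (by norm_num)).differentiable
        (by norm_num) z).hasFDerivAt.sub
      (((contDiff_pd1 (m := 1) hhC (by norm_num)).differentiable
        (by norm_num) z).hasFDerivAt.const_mul ε)).fderiv
    exact DFunLike.congr_fun this (1, 0)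
  have f2 : pd2 (pd2 v) z = pd2 (pd2 w) z - ε * pd2 (pd2 h) z := by
    rw [e2]
    have := (((contDiff_pd2 (m := 1) hw (by norm_num)).differentiable
        (by norm_num) z).hasFDerivAt.sub
      (((contDiff_pd2 (m := 1) hhC (by norm_num)).differentiable
        (by norm_num) z).hasFDerivAt.const_mul ε)).fderiv
    exact DFunLike.congr_fun this (0, 1)
  have g1 : 0 ≤ pd1 (pd1 v) z := fderiv_fderiv_nonneg_of_isLocalMin hvC hloc (1, 0)
  have g2 : 0 ≤ pd2 (pd2 v) z := fderiv_fderiv_nonneg_of_isLocalMin hvC hloc (0, 1)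
  have hΔ : M * h z ≤ pd1 (pd1 h) z + pd2 (pd2 h) z := by
    rw [hh, laplacian_exp_sqDist]
    exact mul_le_mul_of_nonneg_right (hkr _ hzr) hhz.le
  have hb := hlap z
  have hlt : M * v z < 0 := mul_neg_of_pos_of_neg hM hvz
  have hMc : 0 < M * (ε * c) := by positivity
  have hεΔ := mul_le_mul_of_nonneg_left hΔ hε.le
  have hvz' : M * v z = M * w z - ε * (M * h z) + M * (ε * c) := by simp only [hv]; ring
  linarith

theorem inner_covariant (a : ℝ) (z w z' w' : ℂ) :
    inner ℝ z (w' + I * a * w) + inner ℝ (z' + I * a * z) w = inner ℝ z w' + inner ℝ z' w := by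
  simp [Complex.inner]; ring

theorem pd1_inner (a : ℝ × ℝ → ℝ) {φ ψ : ℝ × ℝ → ℂ} (hφ : Differentiable ℝ φ)
    (hψ : Differentiable ℝ ψ) (x : ℝ × ℝ) :
    pd1 (fun y => inner ℝ (φ y) (ψ y)) x
      = inner ℝ (φ x) (D1 a ψ x) + inner ℝ (D1 a φ x) (ψ x) := by
  rw [pd1, fderiv_inner_apply ℝ (hφ x) (hψ x)]
  exact (inner_covariant _ _ _ _ _).symm

theorem pd2_inner (a : ℝ × ℝ → ℝ) {φ ψ : ℝ × ℝ → ℂ} (hφ : Differentiable ℝ φ)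
    (hψ : Differentiable ℝ ψ) (x : ℝ × ℝ) :
    pd2 (fun y => inner ℝ (φ y) (ψ y)) x
      = inner ℝ (φ x) (D2 a ψ x) + inner ℝ (D2 a φ x) (ψ x) := by
  rw [pd2, fderiv_inner_apply ℝ (hφ x) (hψ x)]
  exact (inner_covariant _ _ _ _ _).symm

theorem pd1_pd1_normSq {a : ℝ × ℝ → ℝ} {φ : ℝ × ℝ → ℂ} (ha : ContDiff ℝ 1 a)
    (hφ : ContDiff ℝ 2 φ) (x : ℝ × ℝ) :
    pd1 (pd1 fun y => ‖φ y‖ ^ 2) x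
      = 2 * ‖D1 a φ x‖ ^ 2 + 2 * inner ℝ (φ x) (D1 a (D1 a φ) x) := by
  have hφ1 : Differentiable ℝ φ := hφ.differentiable (by norm_num)
  have hD : Differentiable ℝ (D1 a φ) := ((contDiff_pd1 (m := 1) hφ (by norm_num)).add
    ((contDiff_const.mul (ofRealCLM.contDiff.comp ha)).mul
      (hφ.of_le (by norm_num)))).differentiable (by norm_num)
  have h1 : (pd1 fun y => ‖φ y‖ ^ 2) = fun y => 2 * inner ℝ (φ y) (D1 a φ y) := by
    funext y
    simp_rw [← real_inner_self_eq_norm_sq]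
    rw [pd1_inner a hφ1 hφ1, real_inner_comm (φ y)]; ring
  rw [h1, pd1, fderiv_const_mul ((hφ1.inner ℝ hD) x)]
  have := pd1_inner a hφ1 hD x
  rw [pd1] at this
  rw [smul_apply, this, real_inner_self_eq_norm_sq, smul_eq_mul]; ring

theorem pd2_pd2_normSq {a : ℝ × ℝ → ℝ} {φ : ℝ × ℝ → ℂ} (ha : ContDiff ℝ 1 a)
    (hφ : ContDiff ℝ 2 φ) (x : ℝ × ℝ) :
    pd2 (pd2 fun y => ‖φ y‖ ^ 2) x
      = 2 * ‖D2 a φ x‖ ^ 2 + 2 * inner ℝ (φ x) (D2 a (D2 a φ) x) := by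
  have hφ1 : Differentiable ℝ φ := hφ.differentiable (by norm_num)
  have hD : Differentiable ℝ (D2 a φ) := ((contDiff_pd2 (m := 1) hφ (by norm_num)).add
    ((contDiff_const.mul (ofRealCLM.contDiff.comp ha)).mul
      (hφ.of_le (by norm_num)))).differentiable (by norm_num)
  have h1 : (pd2 fun y => ‖φ y‖ ^ 2) = fun y => 2 * inner ℝ (φ y) (D2 a φ y) := by
    funext y
    simp_rw [← real_inner_self_eq_norm_sq]
    rw [pd2_inner a hφ1 hφ1, real_inner_comm (φ y)]; ring
  rw [h1, pd2, fderiv_const_mul ((hφ1.inner ℝ hD) x)]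
  have := pd2_inner a hφ1 hD x
  rw [pd2] at this
  rw [smul_apply, this, real_inner_self_eq_norm_sq, smul_eq_mul]; ring

theorem laplacian_normSq_of_isGLSolution {α β : ℝ} {F₀ : ℝ × ℝ → ℝ} {d : ℤ} {P : FieldPair d}
    (hP : IsGLSolution α β F₀ P) (x : ℝ × ℝ) :
    pd1 (pd1 fun y => ‖P.φ y‖ ^ 2) x + pd2 (pd2 fun y => ‖P.φ y‖ ^ 2) x
      = 2 * (‖D1 P.a1 P.φ x‖ ^ 2 + ‖D2 P.a2 P.φ x‖ ^ 2)
        + 2 * ‖P.φ x‖ ^ 2 * (β * ‖P.φ x‖ ^ 2 - α) := by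
  have hφ : ContDiff ℝ 2 P.φ := contDiff_infty.1 P.smooth_φ 2
  rw [pd1_pd1_normSq (P.smooth_a1.of_le (by exact_mod_cast le_top)) hφ,
    pd2_pd2_normSq (P.smooth_a2.of_le (by exact_mod_cast le_top)) hφ]
  have h := hP.2.2 x
  have h2 : D1 P.a1 (D1 P.a1 P.φ) x + D2 P.a2 (D2 P.a2 P.φ) x
      = (β * ‖P.φ x‖ ^ 2 - α) • P.φ x := by
    rw [real_smul]; push_cast; linear_combination -h
  have h3 := congrArg (inner ℝ (P.φ x)) h2
  rw [inner_add_right, real_inner_smul_right, real_inner_self_eq_norm_sq] at h3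
  linarith

/-- A nowhere vanishing covariantly constant section forces the connection to be flat. -/
theorem curv_eq_zero_of_covariant_const {a1 a2 : ℝ × ℝ → ℝ} {φ : ℝ × ℝ → ℂ}
    (ha1 : Differentiable ℝ a1) (ha2 : Differentiable ℝ a2) (hφ : ContDiff ℝ 2 φ)
    (h1 : ∀ x, D1 a1 φ x = 0) (h2 : ∀ x, D2 a2 φ x = 0) {x : ℝ × ℝ} (hx : φ x ≠ 0) :
    curv a1 a2 x = 0 := by
  have hφ1 : Differentiable ℝ φ := hφ.differentiable (by norm_num)
  have hφ2 : Differentiable ℝ (fderiv ℝ φ) :=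
    (hφ.fderiv_right (m := 1) (by norm_num)).differentiable (by norm_num)
  have e1 : pd1 φ = fun y => a1 y • (-I * φ y) := by
    funext y; have := h1 y; rw [D1] at this; rw [real_smul]; linear_combination this
  have e2 : pd2 φ = fun y => a2 y • (-I * φ y) := by
    funext y; have := h2 y; rw [D2] at this; rw [real_smul]; linear_combination this
  have hsymm : pd1 (pd2 φ) x = pd2 (pd1 φ) x := by
    have hs := (hφ.contDiffAt (x := x)).isSymmSndFDerivAt (by simp)
    have k1 : pd1 (pd2 φ) x = fderiv ℝ (fderiv ℝ φ) x (1, 0) (0, 1) := by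
      show fderiv ℝ (fun y => fderiv ℝ φ y (0, 1)) x (1, 0) = _
      rw [fderiv_clm_apply (hφ2 x) (differentiableAt_const _)]; simp
    have k2 : pd2 (pd1 φ) x = fderiv ℝ (fderiv ℝ φ) x (0, 1) (1, 0) := by
      show fderiv ℝ (fun y => fderiv ℝ φ y (1, 0)) x (0, 1) = _
      rw [fderiv_clm_apply (hφ2 x) (differentiableAt_const _)]; simp
    rw [k1, k2, hs.eq]
  have hd : Differentiable ℝ fun y => -I * φ y := hφ1.const_mul _
  have e1x := congrFun e1 x
  have e2x := congrFun e2 x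
  rw [e1, e2, pd1, pd2, fderiv_fun_smul (ha2 x) (hd x), fderiv_fun_smul (ha1 x) (hd x),
    fderiv_const_mul (hφ1 x)] at hsymm
  simp only [pd1, pd2] at e1x e2x
  simp [e1x, e2x] at hsymm
  have : ((curv a1 a2 x : ℝ) : ℂ) * (I * φ x) = 0 := by
    simp only [curv, pd1, pd2]; push_cast; linear_combination -hsymm
  simpa [hx] using this

theorem integral_curv {d : ℤ} (P : FieldPair d) :
    ∫ x in unitSquare, curv P.a1 P.a2 x = 2 * Real.pi * d := by
  have hd1 : Differentiable ℝ P.a1 := P.smooth_a1.differentiable (by simp)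
  have hd2 : Differentiable ℝ P.a2 := P.smooth_a2.differentiable (by simp)
  have hcont : Continuous fun x : ℝ × ℝ => fderiv ℝ P.a2 x (1, 0) + (-fderiv ℝ P.a1 x) (0, 1) :=
    ((contDiff_pd1 (m := 0) P.smooth_a2 (by simp)).continuous).add
      ((contDiff_pd2 (m := 0) P.smooth_a1 (by simp)).continuous.neg)
  have key := integral_divergence_prod_Icc_of_hasFDerivAt_of_le P.a2 (fun x => -P.a1 x)
    (fun x => fderiv ℝ P.a2 x) (fun x => -fderiv ℝ P.a1 x) (0, 0) (1, 1) (by simp [Prod.le_def])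
    hd2.continuous.continuousOn hd1.continuous.neg.continuousOn
    (fun x _ => (hd2 x).hasFDerivAt) (fun x _ => (hd1 x).hasFDerivAt.neg)
    (hcont.continuousOn.integrableOn_compact isCompact_Icc)
  have hb1 : ∀ y, P.a2 (1, y) = P.a2 (0, y) := fun y => by simpa using P.per1_a2 (0, y)
  have hb2 : ∀ t, P.a1 (t, 1) = P.a1 (t, 0) - 2 * Real.pi * d := fun t => by
    simpa using P.per2_a1 (t, 0)
  have hi : IntervalIntegrable (fun t => P.a1 (t, 0)) volume 0 1 :=
    (hd1.continuous.comp (by fun_prop)).intervalIntegrable _ _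
  simp only [hb1, hb2, intervalIntegral.integral_neg] at key
  rw [intervalIntegral.integral_sub hi intervalIntegrable_const] at key
  simp only [intervalIntegral.integral_const] at key
  calc ∫ x in unitSquare, curv P.a1 P.a2 x
      = ∫ x in Set.Icc ((0, 0) : ℝ × ℝ) (1, 1),
          fderiv ℝ P.a2 x (1, 0) + (-fderiv ℝ P.a1 x) (0, 1) := rfl
    _ = 2 * Real.pi * d := by rw [key]; simp

theorem FieldPair.norm_φ_add_one_left {d : ℤ} (P : FieldPair d) (x : ℝ × ℝ) :
    ‖P.φ (x.1 + 1, x.2)‖ = ‖P.φ x‖ := by rw [P.per1_φ]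

theorem FieldPair.norm_φ_add_one_right {d : ℤ} (P : FieldPair d) (x : ℝ × ℝ) :
    ‖P.φ (x.1, x.2 + 1)‖ = ‖P.φ x‖ := by
  rw [P.per2_φ, norm_mul, norm_exp]
  simp

theorem exists_forall_le_of_periodic {u : ℝ × ℝ → ℝ} (hu : Continuous u)
    (h1 : ∀ x : ℝ × ℝ, u (x.1 + 1, x.2) = u x) (h2 : ∀ x : ℝ × ℝ, u (x.1, x.2 + 1) = u x) :
    ∃ p, ∀ x, u x ≤ u p := by
  obtain ⟨p, -, hp⟩ := (isCompact_Icc (a := ((0, 0) : ℝ × ℝ)) (b := (1, 1))).exists_isMaxOn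
    ⟨(0, 0), by simp [Prod.le_def]⟩ hu.continuousOn
  refine ⟨p, fun ⟨s, t⟩ => ?_⟩
  obtain ⟨s', hs', es⟩ := Function.Periodic.exists_mem_Ico₀ (f := fun r => u (r, t)) (c := 1)
    (fun r => h1 (r, t)) one_pos s
  obtain ⟨t', ht', et⟩ := Function.Periodic.exists_mem_Ico₀ (f := fun r => u (s', r)) (c := 1)
    (fun r => h2 (s', r)) one_pos t
  exact (es.trans et).trans_le (hp ⟨⟨hs'.1, ht'.1⟩, ⟨hs'.2.le, ht'.2.le⟩⟩)

theorem normSq_le_of_isGLSolution {α β : ℝ} (hα : 0 < α) (hβ : 0 < β) {F₀ : ℝ × ℝ → ℝ} {d : ℤ}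
    {P : FieldPair d} (hP : IsGLSolution α β F₀ P) (x : ℝ × ℝ) : ‖P.φ x‖ ^ 2 ≤ α / β := by
  have hφ : ContDiff ℝ 2 P.φ := contDiff_infty.1 P.smooth_φ 2
  have hu : ContDiff ℝ 2 fun y => ‖P.φ y‖ ^ 2 := hφ.norm_sq ℝ
  obtain ⟨p, hp⟩ := exists_forall_le_of_periodic hu.continuous
    (fun x => by rw [P.norm_φ_add_one_left]) (fun x => by rw [P.norm_φ_add_one_right])
  refine (hp x).trans ?_
  by_contra! hlt
  have hmin : IsLocalMin (fun y => -‖P.φ y‖ ^ 2) p := .of_forall fun y => neg_le_neg (hp y)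
  have g1 := fderiv_fderiv_nonneg_of_isLocalMin hu.neg hmin (1, 0)
  have g2 := fderiv_fderiv_nonneg_of_isLocalMin hu.neg hmin (0, 1)
  simp only [fderiv_fun_neg, neg_apply] at g1 g2
  have hlap := laplacian_normSq_of_isGLSolution hP p
  have hαβ : 0 < α / β := by positivity
  have hpos : 0 < β * ‖P.φ p‖ ^ 2 - α := by
    rw [div_lt_iff₀ hβ] at hlt; linarith
  have : 0 < 2 * ‖P.φ p‖ ^ 2 * (β * ‖P.φ p‖ ^ 2 - α) :=
    mul_pos (by linarith) hpos
  have hsq : 0 ≤ 2 * (‖D1 P.a1 P.φ p‖ ^ 2 + ‖D2 P.a2 P.φ p‖ ^ 2) := by positivity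
  unfold pd1 pd2 at hlap
  linarith

theorem normSq_eq_of_isGLSolution {α β : ℝ} (hα : 0 < α) (hβ : 0 < β) {F₀ : ℝ × ℝ → ℝ} {d : ℤ}
    {P : FieldPair d} (hP : IsGLSolution α β F₀ P) {x₀ : ℝ × ℝ} (hx₀ : ‖P.φ x₀‖ ^ 2 = α / β)
    (x : ℝ × ℝ) : ‖P.φ x‖ ^ 2 = α / β := by
  have hφ : ContDiff ℝ 2 P.φ := contDiff_infty.1 P.smooth_φ 2
  have hu : ContDiff ℝ 2 fun y => ‖P.φ y‖ ^ 2 := hφ.norm_sq ℝ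
  have e1 : (pd1 fun y => α / β - ‖P.φ y‖ ^ 2) = fun y => -pd1 (fun y => ‖P.φ y‖ ^ 2) y := by
    funext y; rw [pd1, fderiv_const_sub]; rfl
  have e2 : (pd2 fun y => α / β - ‖P.φ y‖ ^ 2) = fun y => -pd2 (fun y => ‖P.φ y‖ ^ 2) y := by
    funext y; rw [pd2, fderiv_const_sub]; rfl
  have hzero := eq_zero_of_laplacian_le (w := fun y => α / β - ‖P.φ y‖ ^ 2)
    (contDiff_const.sub hu) (fun y => sub_nonneg.2 (normSq_le_of_isGLSolution hα hβ hP y))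
    (M := 2 * α) (by positivity) (fun y => ?_) (x₀ := x₀) (by simp [hx₀]) x
  · linarith
  · have hlap := laplacian_normSq_of_isGLSolution hP y
    have e3 : pd1 (fun y => -pd1 (fun y => ‖P.φ y‖ ^ 2) y) y
        = -pd1 (pd1 fun y => ‖P.φ y‖ ^ 2) y := by rw [pd1, fderiv_fun_neg]; rfl
    have e4 : pd2 (fun y => -pd2 (fun y => ‖P.φ y‖ ^ 2) y) y
        = -pd2 (pd2 fun y => ‖P.φ y‖ ^ 2) y := by rw [pd2, fderiv_fun_neg]; rfl
    rw [e1, e2, e3, e4]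
    have hle := normSq_le_of_isGLSolution hα hβ hP y
    have hαβ : β * (α / β) = α := by field_simp
    have hw : 0 ≤ α / β - ‖P.φ y‖ ^ 2 := sub_nonneg.2 hle
    have hw2 : 0 ≤ β * (α / β - ‖P.φ y‖ ^ 2) * (α / β - ‖P.φ y‖ ^ 2) := by positivity
    have hsq : 0 ≤ 2 * (‖D1 P.a1 P.φ y‖ ^ 2 + ‖D2 P.a2 P.φ y‖ ^ 2) := by positivity
    have hα' : 2 * α * (α / β - ‖P.φ y‖ ^ 2) - 2 * (β * (α / β - ‖P.φ y‖ ^ 2) *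
        (α / β - ‖P.φ y‖ ^ 2)) = -(2 * ‖P.φ y‖ ^ 2 * (β * ‖P.φ y‖ ^ 2 - α)) := by
      generalize α / β = c at hαβ
      subst hαβ; ring
    linarith

/-- if equality `|φ(x₀)| = √(α/β)` holds at one point for a degree-`d` GL
solution, it holds everywhere and `d = 0`. -/
theorem statement7 (α β : ℝ) (hα : 0 < α) (hβ : 0 < β) (d : ℤ) (F₀ : ℝ × ℝ → ℝ)
    (hF₀ : ExternalField d F₀) (P : FieldPair d) (hP : IsGLSolution α β F₀ P)
    (x₀ : ℝ × ℝ) (hx₀ : ‖P.φ x₀‖ = Real.sqrt (α / β)) :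
    (∀ x : ℝ × ℝ, ‖P.φ x‖ = Real.sqrt (α / β)) ∧ d = 0 := by
  have hc : 0 < α / β := div_pos hα hβ
  have hsq : ∀ x, ‖P.φ x‖ ^ 2 = α / β :=
    normSq_eq_of_isGLSolution hα hβ hP (by rw [hx₀, Real.sq_sqrt hc.le])
  refine ⟨fun x => by rw [← hsq x, Real.sqrt_sq (norm_nonneg _)], ?_⟩
  have hne : ∀ x, P.φ x ≠ 0 := fun x h => by
    have := hsq x
    simp only [h, norm_zero] at this
    linarith
  have hD : ∀ x, D1 P.a1 P.φ x = 0 ∧ D2 P.a2 P.φ x = 0 := fun x => by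
    have hlap := laplacian_normSq_of_isGLSolution hP x
    have hβα : β * (α / β) - α = 0 := by field_simp; ring
    have z1 : (pd1 fun _ : ℝ × ℝ => α / β) = fun _ => 0 := by funext y; simp [pd1]
    have z2 : (pd2 fun _ : ℝ × ℝ => α / β) = fun _ => 0 := by funext y; simp [pd2]
    simp only [hsq, z1, z2, hβα] at hlap
    simp only [pd1, pd2, fderiv_fun_const, Pi.zero_apply, zero_apply] at hlap
    constructor <;> rw [← norm_eq_zero, ← sq_eq_zero_iff] <;>
      nlinarith [sq_nonneg ‖D1 P.a1 P.φ x‖, sq_nonneg ‖D2 P.a2 P.φ x‖]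
  have hcurv : ∀ x, curv P.a1 P.a2 x = 0 := fun x =>
    curv_eq_zero_of_covariant_const (P.smooth_a1.differentiable (by simp))
      (P.smooth_a2.differentiable (by simp)) (contDiff_infty.1 P.smooth_φ 2)
      (fun y => (hD y).1) (fun y => (hD y).2) (hne x)
  have hint := integral_curv P
  simp only [hcurv, integral_zero] at hint
  simpa [Real.pi_ne_zero] using hint.symm
end
end
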